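/- arXiv:2301.10447 — 2 statements merged into one kernel-verified Lean document; each statement's English description precedes it below -/
import Mathlib

section
/- Let C = {[x₀:x₁:x₂] ∈ ℙ²(ℂ) : x₀x₂ = x₁²} be a smooth conic and let s be a positive integer. Then there exist lines L₁, …, L_s ⊆ ℙ²(ℂ), points p₁, …, p_s, q₁, …, q_s ∈ C, and open sets W ⊇ C and W_j ⊇ L_j (1 ≤ j ≤ s) with the following properties: (1) for each j, L_j ∩ C = {p_j, q_j} with p_j ≠ q_j; (2) the 2s points p₁, …, p_s, q₁, …, q_s are pairwise distinct; (3) for each j, W_j ∩ W ∩ {p₁, …, p_s, q₁, …, q_s} = {p_j, q_j}; (4) for each j, the open set W_j ∩ W has exactly two connected components, P_j containing p_j and Q_j containing q_j; (5) the closures of these components satisfy cl(P_i) ∩ cl(P_j) = ∅ for i ≠ j, cl(Q_i) ∩ cl(Q_j) = ∅ for i ≠ j, and cl(P_i) ∩ cl(Q_j) = ∅ for all i, j. -/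
open Set

/-- The relation on `ℂ^{n+1} \ {0}` whose quotient is complex projective `n`-space:
two nonzero vectors are related iff they differ by a nonzero scalar. -/
def projRel (n : ℕ) : {v : Fin (n + 1) → ℂ // v ≠ 0} → {v : Fin (n + 1) → ℂ // v ≠ 0} → Prop :=
  fun v w => ∃ c : ℂ, c ≠ 0 ∧ c • v.1 = w.1

/-- Complex projective `n`-space `ℙⁿ(ℂ)`, as the quotient of `ℂ^{n+1} \ {0}` by scalar
multiplication, with the quotient topology. -/
def Proj (n : ℕ) : Type := Quot (projRel n)

instance (n : ℕ) : TopologicalSpace (Proj n) :=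
  inferInstanceAs (TopologicalSpace (Quot (projRel n)))

/-- The smooth conic `{[x₀:x₁:x₂] : x₀ x₂ = x₁²}` in `ℙ²(ℂ)`. -/
def conic : Set (Proj 2) :=
  {p | ∃ v : {v : Fin 3 → ℂ // v ≠ 0}, p = Quot.mk (projRel 2) v ∧ v.1 0 * v.1 2 = v.1 1 ^ 2}

/-- A line in `ℙ²(ℂ)`: the zero locus of a nonzero linear form on `ℂ³`. -/
def IsLine (L : Set (Proj 2)) : Prop :=
  ∃ a : Fin 3 → ℂ, a ≠ 0 ∧
    L = {p | ∃ v : {v : Fin 3 → ℂ // v ≠ 0}, p = Quot.mk (projRel 2) v ∧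
            a 0 * v.1 0 + a 1 * v.1 1 + a 2 * v.1 2 = 0}

/-- The point of projective space with given homogeneous coordinates. -/
def projMk {n : ℕ} (v : {v : Fin (n + 1) → ℂ // v ≠ 0}) : Proj n := Quot.mk (projRel n) v

/-- The subset of projective space cut out by a predicate on homogeneous coordinates. -/
def projSet {n : ℕ} (φ : (Fin (n + 1) → ℂ) → Prop) : Set (Proj n) :=
  {p | ∃ v : {v : Fin (n + 1) → ℂ // v ≠ 0}, p = projMk v ∧ φ v.1}

/-- A predicate on homogeneous coordinates that is unchanged by nonzero scalars. -/
def ScaleInvariant {n : ℕ} (φ : (Fin (n + 1) → ℂ) → Prop) : Prop :=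
  ∀ (c : ℂ) (v : Fin (n + 1) → ℂ), c ≠ 0 → (φ (c • v) ↔ φ v)

theorem mk_mem_projSet {n : ℕ} {φ : (Fin (n + 1) → ℂ) → Prop} (hφ : ScaleInvariant φ)
    (v : {v : Fin (n + 1) → ℂ // v ≠ 0}) :
    projMk v ∈ projSet φ ↔ φ v.1 := by
  refine ⟨?_, fun h => ⟨v, rfl, h⟩⟩
  rintro ⟨w, hw, hφw⟩
  have key : ∀ v w : {v : Fin (n + 1) → ℂ // v ≠ 0}, projRel n v w → φ v.1 = φ w.1 := by
    rintro v w ⟨c, hc, hcv⟩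
    rw [← hcv, hφ c v.1 hc]
  have h : φ v.1 = φ w.1 := congrArg (Quot.lift (fun v : {v : Fin (n + 1) → ℂ // v ≠ 0} => φ v.1) key) hw
  rwa [h]

theorem isQuotientMap_projMk {n : ℕ} : Topology.IsQuotientMap (projMk (n := n)) :=
  isQuotientMap_quot_mk

theorem preimage_projSet {n : ℕ} {φ : (Fin (n + 1) → ℂ) → Prop} (hφ : ScaleInvariant φ) :
    projMk ⁻¹' projSet φ = Subtype.val ⁻¹' {v | φ v} := by
  ext v
  exact mk_mem_projSet hφ v

theorem isOpen_projSet {n : ℕ} {φ : (Fin (n + 1) → ℂ) → Prop} (hφ : ScaleInvariant φ)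
    (h : IsOpen {v | φ v}) : IsOpen (projSet φ) := by
  refine isQuotientMap_projMk.isOpen_preimage.1 ?_
  rw [preimage_projSet hφ]
  exact h.preimage continuous_subtype_val

theorem isClosed_projSet {n : ℕ} {φ : (Fin (n + 1) → ℂ) → Prop} (hφ : ScaleInvariant φ)
    (h : IsClosed {v | φ v}) : IsClosed (projSet φ) := by
  refine isQuotientMap_projMk.isClosed_preimage.1 ?_
  rw [preimage_projSet hφ]
  exact h.preimage continuous_subtype_val

/-- The point `[1 : y : z]` of the projective plane. -/
def affinePoint (y z : ℂ) : Proj 2 :=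
  projMk ⟨![1, y, z], fun h => one_ne_zero (congrFun h 0)⟩

theorem continuous_affinePoint : Continuous fun x : ℂ × ℂ => affinePoint x.1 x.2 := by
  refine isQuotientMap_projMk.continuous.comp (Continuous.subtype_mk (continuous_pi fun i => ?_) _)
  fin_cases i <;> simp <;> fun_prop

theorem mk_eq_affinePoint (v : {v : Fin 3 → ℂ // v ≠ 0}) (h : v.1 0 ≠ 0) :
    projMk v = affinePoint (v.1 1 / v.1 0) (v.1 2 / v.1 0) := by
  refine (Quot.sound ⟨v.1 0, h, ?_⟩).symm
  ext i
  fin_cases i <;> simp <;> field_simp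

theorem affinePoint_mem_projSet {φ : (Fin 3 → ℂ) → Prop} (hφ : ScaleInvariant (n := 2) φ)
    (y z : ℂ) : affinePoint y z ∈ projSet φ ↔ φ ![1, y, z] :=
  mk_mem_projSet hφ _

theorem norm_linear_smul (c b x y : ℂ) : ‖c * x - b * (c * y)‖ = ‖c‖ * ‖x - b * y‖ := by
  rw [← norm_mul]
  ring_nf

theorem norm_quadratic_smul (c x y z : ℂ) :
    ‖c * x * (c * z) - c ^ 2 * y ^ 2‖ = ‖c‖ ^ 2 * ‖x * z - y ^ 2‖ := by
  rw [← norm_pow, ← norm_mul]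
  ring_nf

theorem connectedComponentIn_union_left {X : Type*} [TopologicalSpace X] {A B : Set X}
    (hA : IsOpen A) (hB : IsOpen B) (hAB : Disjoint A B) (hc : IsPreconnected A) {x : X}
    (hx : x ∈ A) : connectedComponentIn (A ∪ B) x = A := by
  refine Subset.antisymm ?_ (hc.subset_connectedComponentIn hx subset_union_left)
  exact isPreconnected_connectedComponentIn.subset_left_of_subset_union hA hB hAB
    (connectedComponentIn_subset _ _) ⟨x, mem_connectedComponentIn (Or.inl hx), hx⟩

/-- The predicate cutting out a neighbourhood of the conic. -/
def NearConic (R : ℝ) (v : Fin 3 → ℂ) : Prop :=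
  ‖v 0 * v 2 - v 1 ^ 2‖ < 1 / 32 * ‖v 0‖ ^ 2 ∨ (R * ‖v 0‖ < ‖v 2‖ ∧ ‖v 1‖ < ‖v 2‖)

/-- The predicate cutting out a neighbourhood of the line `x₂ = b² x₀`. -/
def NearLine (R : ℝ) (b : ℂ) (v : Fin 3 → ℂ) : Prop :=
  ((‖v 1 - b * v 0‖ < 1 / 4 * ‖v 0‖ ∨ ‖v 1 - -b * v 0‖ < 1 / 4 * ‖v 0‖) ∧ ‖v 2‖ < R * ‖v 0‖) ∨
    (1 / 32 * ‖v 0‖ ^ 2 < ‖v 0 * v 2 - v 1 ^ 2‖ ∧ (‖v 2‖ < R * ‖v 0‖ ∨ ‖v 2‖ < ‖v 1‖))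

/-- The predicate cutting out a neighbourhood of the point `[1 : b : b²]`. -/
def NearPoint (b : ℂ) (v : Fin 3 → ℂ) : Prop :=
  ‖v 1 - b * v 0‖ < 1 / 4 * ‖v 0‖ ∧ ‖v 0 * v 2 - v 1 ^ 2‖ < 1 / 32 * ‖v 0‖ ^ 2

/-- The predicate cutting out a closed set containing the neighbourhood `NearPoint b`. -/
def NearPointClosed (R : ℝ) (b : ℂ) (v : Fin 3 → ℂ) : Prop :=
  ‖v 1 - b * v 0‖ ≤ 1 / 4 * ‖v 0‖ ∧ ‖v 2‖ ≤ R * ‖v 0‖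

theorem nearConic_scaleInvariant (R : ℝ) : ScaleInvariant (n := 2) (NearConic R) := by
  intro c v hc
  have hc' : 0 < ‖c‖ := norm_pos_iff.2 hc
  simp only [NearConic, Pi.smul_apply, smul_eq_mul, norm_quadratic_smul, norm_mul, mul_pow,
    mul_left_comm _ ‖c‖, mul_left_comm _ (‖c‖ ^ 2), mul_lt_mul_iff_right₀ hc',
    mul_lt_mul_iff_right₀ (pow_pos hc' 2)]

theorem nearLine_scaleInvariant (R : ℝ) (b : ℂ) : ScaleInvariant (n := 2) (NearLine R b) := by
  intro c v hc
  have hc' : 0 < ‖c‖ := norm_pos_iff.2 hc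
  simp only [NearLine, Pi.smul_apply, smul_eq_mul, norm_quadratic_smul, norm_linear_smul, norm_mul,
    mul_pow, mul_left_comm _ ‖c‖, mul_left_comm _ (‖c‖ ^ 2), mul_lt_mul_iff_right₀ hc',
    mul_lt_mul_iff_right₀ (pow_pos hc' 2)]

theorem nearPoint_scaleInvariant (b : ℂ) : ScaleInvariant (n := 2) (NearPoint b) := by
  intro c v hc
  have hc' : 0 < ‖c‖ := norm_pos_iff.2 hc
  simp only [NearPoint, Pi.smul_apply, smul_eq_mul, norm_quadratic_smul, norm_linear_smul, norm_mul,
    mul_pow, mul_left_comm _ ‖c‖, mul_left_comm _ (‖c‖ ^ 2), mul_lt_mul_iff_right₀ hc',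
    mul_lt_mul_iff_right₀ (pow_pos hc' 2)]

theorem nearPointClosed_scaleInvariant (R : ℝ) (b : ℂ) :
    ScaleInvariant (n := 2) (NearPointClosed R b) := by
  intro c v hc
  have hc' : 0 < ‖c‖ := norm_pos_iff.2 hc
  simp only [NearPointClosed, Pi.smul_apply, smul_eq_mul, norm_linear_smul, norm_mul,
    mul_left_comm _ ‖c‖, mul_le_mul_iff_right₀ hc']

theorem isOpen_nearConic (R : ℝ) : IsOpen (projSet (n := 2) (NearConic R)) := by
  refine isOpen_projSet (nearConic_scaleInvariant R) ?_
  simp only [NearConic, ofPred_or, ofPred_and]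
  refine IsOpen.union ?_ (IsOpen.inter ?_ ?_) <;>
    exact isOpen_lt (by fun_prop) (by fun_prop)

theorem isOpen_nearLine (R : ℝ) (b : ℂ) : IsOpen (projSet (n := 2) (NearLine R b)) := by
  refine isOpen_projSet (nearLine_scaleInvariant R b) ?_
  simp only [NearLine, ofPred_or, ofPred_and]
  refine IsOpen.union (IsOpen.inter (IsOpen.union ?_ ?_) ?_)
    (IsOpen.inter ?_ (IsOpen.union ?_ ?_)) <;>
    exact isOpen_lt (by fun_prop) (by fun_prop)

theorem isOpen_nearPoint (b : ℂ) : IsOpen (projSet (n := 2) (NearPoint b)) := by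
  refine isOpen_projSet (nearPoint_scaleInvariant b) ?_
  simp only [NearPoint, ofPred_and]
  refine IsOpen.inter ?_ ?_ <;>
    exact isOpen_lt (by fun_prop) (by fun_prop)

theorem isClosed_nearPointClosed (R : ℝ) (b : ℂ) :
    IsClosed (projSet (n := 2) (NearPointClosed R b)) := by
  refine isClosed_projSet (nearPointClosed_scaleInvariant R b) ?_
  simp only [NearPointClosed, ofPred_and]
  refine IsClosed.inter ?_ ?_ <;>
    exact isClosed_le (by fun_prop) (by fun_prop)

theorem affinePoint_mem_nearConic {R : ℝ} {y z : ℂ} :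
    affinePoint y z ∈ projSet (n := 2) (NearConic R) ↔
      ‖z - y ^ 2‖ < 1 / 32 ∨ (R < ‖z‖ ∧ ‖y‖ < ‖z‖) := by
  rw [affinePoint_mem_projSet (nearConic_scaleInvariant R)]
  simp [NearConic]

theorem affinePoint_mem_nearLine {R : ℝ} {b y z : ℂ} :
    affinePoint y z ∈ projSet (n := 2) (NearLine R b) ↔
      ((‖y - b‖ < 1 / 4 ∨ ‖y + b‖ < 1 / 4) ∧ ‖z‖ < R) ∨
        (1 / 32 < ‖z - y ^ 2‖ ∧ (‖z‖ < R ∨ ‖z‖ < ‖y‖)) := by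
  rw [affinePoint_mem_projSet (nearLine_scaleInvariant R b)]
  simp [NearLine]

theorem affinePoint_mem_nearPoint {b y z : ℂ} :
    affinePoint y z ∈ projSet (n := 2) (NearPoint b) ↔
      ‖y - b‖ < 1 / 4 ∧ ‖z - y ^ 2‖ < 1 / 32 := by
  rw [affinePoint_mem_projSet (nearPoint_scaleInvariant b)]
  simp [NearPoint]

theorem nearPoint_eq_image (b : ℂ) :
    projSet (n := 2) (NearPoint b) = (fun x : ℂ × ℂ => affinePoint x.1 (x.1 ^ 2 + x.2)) ''
      (Metric.ball b (1 / 4) ×ˢ Metric.ball 0 (1 / 32)) := by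
  ext p
  constructor
  · rintro ⟨v, rfl, h⟩
    have h0 : v.1 0 ≠ 0 := by
      intro h0
      have := h.1
      simp only [h0, norm_zero, mul_zero] at this
      exact absurd this (norm_nonneg _).not_gt
    have hmem : projMk v ∈ projSet (n := 2) (NearPoint b) := ⟨v, rfl, h⟩
    rw [mk_eq_affinePoint v h0, affinePoint_mem_nearPoint] at hmem
    refine ⟨(v.1 1 / v.1 0, v.1 2 / v.1 0 - (v.1 1 / v.1 0) ^ 2), ⟨?_, ?_⟩, ?_⟩
    · simpa [dist_eq_norm] using hmem.1
    · simpa [dist_eq_norm] using hmem.2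
    · rw [mk_eq_affinePoint v h0]
      simp
  · rintro ⟨x, ⟨h1, h2⟩, rfl⟩
    rw [affinePoint_mem_nearPoint]
    simp only [Metric.mem_ball, dist_eq_norm, sub_zero] at h1 h2
    exact ⟨h1, by simpa using h2⟩

theorem isPreconnected_nearPoint (b : ℂ) : IsPreconnected (projSet (n := 2) (NearPoint b)) := by
  rw [nearPoint_eq_image]
  refine IsPreconnected.image ?_ _ (Continuous.continuousOn ?_)
  · exact ((convex_ball _ _).prod (convex_ball _ _)).isPreconnected
  · exact continuous_affinePoint.comp (f := fun x : ℂ × ℂ => (x.1, x.1 ^ 2 + x.2)) (by fun_prop)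

theorem norm_lt_of_near {R : ℝ} {b y z : ℂ} (hR : (‖b‖ + 1) ^ 2 + 1 ≤ R)
    (hy : ‖y - b‖ < 1 / 4) (hz : ‖z - y ^ 2‖ < 1 / 32) : ‖z‖ < R := by
  have h1 : ‖y‖ ≤ ‖b‖ + 1 := by
    have := norm_sub_norm_le y b
    linarith
  have h2 : ‖z‖ - ‖y‖ ^ 2 ≤ ‖z - y ^ 2‖ := by
    rw [← norm_pow]
    exact norm_sub_norm_le _ _
  have h3 : ‖y‖ ^ 2 ≤ (‖b‖ + 1) ^ 2 := by gcongr
  linarith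

theorem closure_nearPoint_subset {R : ℝ} {b : ℂ} (hR : (‖b‖ + 1) ^ 2 + 1 ≤ R) :
    closure (projSet (n := 2) (NearPoint b)) ⊆ projSet (n := 2) (NearPointClosed R b) := by
  refine closure_minimal ?_ (isClosed_nearPointClosed R b)
  rw [nearPoint_eq_image]
  rintro _ ⟨x, ⟨h1, h2⟩, rfl⟩
  simp only [Metric.mem_ball, dist_eq_norm, sub_zero] at h1 h2
  rw [affinePoint_mem_projSet (nearPointClosed_scaleInvariant R b)]
  have := norm_lt_of_near (z := x.1 ^ 2 + x.2) hR h1 (by simpa using h2)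
  exact ⟨by simpa using h1.le, by simpa using this.le⟩

theorem closure_nearPoint_inter {b c : ℂ} (h : 1 ≤ ‖b - c‖) :
    closure (projSet (n := 2) (NearPoint b)) ∩ closure (projSet (n := 2) (NearPoint c)) = ∅ := by
  refine eq_empty_of_forall_notMem ?_
  rintro p ⟨hb, hc⟩
  obtain ⟨v, rfl, hv⟩ := closure_nearPoint_subset le_rfl hb
  have hw := closure_nearPoint_subset le_rfl hc
  rw [mk_mem_projSet (nearPointClosed_scaleInvariant _ c)] at hw
  have h0 : v.1 0 ≠ 0 := by
    intro h0
    obtain ⟨h1, h2⟩ := hv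
    simp only [h0, mul_zero, norm_zero, sub_zero, norm_le_zero_iff] at h1 h2
    apply v.2
    ext i
    fin_cases i <;> simp [h0, h1, h2]
  have h1 : ‖b - c‖ * ‖v.1 0‖ ≤ ‖v.1 1 - c * v.1 0‖ + ‖v.1 1 - b * v.1 0‖ := by
    rw [← norm_mul]
    refine le_trans (le_of_eq ?_) (norm_sub_le _ _)
    ring_nf
  have h2 : 0 < ‖v.1 0‖ := norm_pos_iff.2 h0
  have h3 := hv.1
  have h4 := hw.1
  nlinarith

theorem nearLine_inter_nearConic {R : ℝ} {b : ℂ} (hR : (‖b‖ + 1) ^ 2 + 1 ≤ R) :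
    projSet (n := 2) (NearLine R b) ∩ projSet (n := 2) (NearConic R) =
      projSet (n := 2) (NearPoint b) ∪ projSet (n := 2) (NearPoint (-b)) := by
  ext p
  constructor
  · rintro ⟨⟨v, rfl, hv⟩, hw⟩
    by_cases h0 : v.1 0 = 0
    · rw [mk_mem_projSet (nearConic_scaleInvariant R)] at hw
      exfalso
      simp only [NearLine, NearConic, h0, norm_zero, mul_zero] at hv hw
      have h1 := norm_nonneg (v.1 1)
      have h2 := norm_nonneg (v.1 2)
      have h3 := norm_nonneg (0 * v.1 2 - v.1 1 ^ 2)
      grind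
    · have hv' : projMk v ∈ projSet (n := 2) (NearLine R b) := ⟨v, rfl, hv⟩
      rw [mk_eq_affinePoint v h0] at hv' hw ⊢
      rw [affinePoint_mem_nearLine] at hv'
      rw [affinePoint_mem_nearConic] at hw
      rw [mem_union, affinePoint_mem_nearPoint, affinePoint_mem_nearPoint, sub_neg_eq_add]
      grind
  · have hR' : (‖-b‖ + 1) ^ 2 + 1 ≤ R := by rwa [norm_neg]
    rintro (h | h) <;>
    · rw [nearPoint_eq_image] at h
      obtain ⟨x, ⟨h1, h2⟩, rfl⟩ := h
      simp only [Metric.mem_ball, dist_eq_norm, sub_zero] at h1 h2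
      have h3 : ‖x.1 ^ 2 + x.2 - x.1 ^ 2‖ < 1 / 32 := by simpa using h2
      have h4 := norm_lt_of_near (by assumption) h1 h3
      rw [mem_inter_iff, affinePoint_mem_nearLine, affinePoint_mem_nearConic,
        ← sub_neg_eq_add x.1 b]
      grind

theorem conic_subset_nearConic (R : ℝ) : conic ⊆ projSet (n := 2) (NearConic R) := by
  rintro _ ⟨v, rfl, hv⟩
  refine ⟨v, rfl, ?_⟩
  by_cases h0 : v.1 0 = 0
  · right
    have h1 : v.1 1 = 0 := by simpa [h0] using hv.symm
    have h2 : v.1 2 ≠ 0 := by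
      intro h2
      apply v.2
      ext i
      fin_cases i <;> simp [h0, h1, h2]
    simpa [h0, h1] using h2
  · left
    rw [hv, sub_self, norm_zero]
    positivity

/-- The line `x₂ = b² x₀`. -/
def chord (b : ℂ) : Set (Proj 2) :=
  projSet (n := 2) fun v => -b ^ 2 * v 0 + 0 * v 1 + 1 * v 2 = 0

theorem isLine_chord (b : ℂ) : IsLine (chord b) :=
  ⟨![-b ^ 2, 0, 1], fun h => one_ne_zero (congrFun h 2), rfl⟩

theorem affinePoint_mem_conic (b : ℂ) : affinePoint b (b ^ 2) ∈ conic :=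
  ⟨_, rfl, by simp⟩

theorem chord_inter_conic {b : ℂ} :
    chord b ∩ conic = {affinePoint b (b ^ 2), affinePoint (-b) ((-b) ^ 2)} := by
  ext p
  constructor
  · rintro ⟨⟨v, rfl, hv⟩, hw⟩
    have hw' : v.1 0 * v.1 2 = v.1 1 ^ 2 :=
      (mk_mem_projSet (φ := fun v : Fin 3 → ℂ => v 0 * v 2 = v 1 ^ 2) (n := 2) (fun c v hc => by
        simp only [Pi.smul_apply, smul_eq_mul]
        rw [show c * v 0 * (c * v 2) = c ^ 2 * (v 0 * v 2) by ring, mul_pow]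
        exact mul_right_inj' (pow_ne_zero 2 hc)) v).1 hw
    have h2 : v.1 2 = b ^ 2 * v.1 0 := by linear_combination hv
    have h0 : v.1 0 ≠ 0 := by
      intro h0
      rw [h0, mul_zero] at h2
      have h1 : v.1 1 = 0 := by simpa [h0] using hw'.symm
      apply v.2
      ext i
      fin_cases i <;> simp [h0, h1, h2]
    have hz : v.1 2 / v.1 0 = b ^ 2 := by rw [h2]; field_simp
    have hy : (v.1 1 / v.1 0) ^ 2 = b ^ 2 := by
      rw [div_pow, ← hw', h2]
      field_simp
    rw [mk_eq_affinePoint v h0, hz, neg_sq]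
    rcases sq_eq_sq_iff_eq_or_eq_neg.1 hy with h | h <;> simp [h]
  · rintro (rfl | rfl)
    · exact ⟨⟨_, rfl, by simp⟩, affinePoint_mem_conic _⟩
    · exact ⟨⟨_, rfl, by simp⟩, affinePoint_mem_conic _⟩

theorem chord_subset_nearLine {R : ℝ} {b : ℂ} (hR : (‖b‖ + 1) ^ 2 + 1 ≤ R) :
    chord b ⊆ projSet (n := 2) (NearLine R b) := by
  rintro _ ⟨v, rfl, hv⟩
  have h2 : v.1 2 = b ^ 2 * v.1 0 := by linear_combination hv
  by_cases h0 : v.1 0 = 0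
  · refine ⟨v, rfl, Or.inr ?_⟩
    rw [h0, mul_zero] at h2
    have h1 : v.1 1 ≠ 0 := by
      intro h1
      apply v.2
      ext i
      fin_cases i <;> simp [h0, h1, h2]
    have h1' := norm_pos_iff.2 h1
    refine ⟨?_, Or.inr ?_⟩
    · simp [h0, h1]
    · rwa [h2, norm_zero]
  · rw [mk_eq_affinePoint v h0, affinePoint_mem_nearLine]
    have hz : v.1 2 / v.1 0 = b ^ 2 := by rw [h2]; field_simp
    rw [hz]
    generalize v.1 1 / v.1 0 = y
    have hb : ‖b ^ 2‖ < R := by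
      rw [norm_pow]
      nlinarith [norm_nonneg b]
    by_cases hy : 1 / 32 < ‖b ^ 2 - y ^ 2‖
    · exact Or.inr ⟨hy, Or.inl hb⟩
    · refine Or.inl ⟨?_, hb⟩
      by_contra! h
      have : ‖b ^ 2 - y ^ 2‖ = ‖y - b‖ * ‖y + b‖ := by
        rw [← norm_mul, ← norm_neg]
        ring_nf
      nlinarith

theorem affinePoint_mem_nearPoint_self (b : ℂ) :
    affinePoint b (b ^ 2) ∈ projSet (n := 2) (NearPoint b) := by
  rw [affinePoint_mem_nearPoint]
  norm_num

theorem disjoint_nearPoint {b c : ℂ} (h : 1 ≤ ‖b - c‖) :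
    Disjoint (projSet (n := 2) (NearPoint b)) (projSet (n := 2) (NearPoint c)) :=
  (disjoint_iff_inter_eq_empty.2 (closure_nearPoint_inter h)).mono subset_closure subset_closure

theorem affinePoint_ne {b c : ℂ} (h : 1 ≤ ‖b - c‖) :
    affinePoint b (b ^ 2) ≠ affinePoint c (c ^ 2) := fun he =>
  (disjoint_nearPoint h).ne_of_mem (affinePoint_mem_nearPoint_self b)
    (affinePoint_mem_nearPoint_self c) he

/-- For every positive integer `s` there exist lines `L₁,…,L_s ⊆ ℙ²(ℂ)`,
points `p₁,…,p_s,q₁,…,q_s` on the conic `C`, and open sets `W ⊇ C`, `W_j ⊇ L_j`, such that: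
(1) `L_j ∩ C = {p_j, q_j}` with `p_j ≠ q_j`; (2) the `2s` points are pairwise distinct;
(3) `W_j ∩ W ∩ {p₁,…,p_s,q₁,…,q_s} = {p_j, q_j}`; (4) `W_j ∩ W` has precisely two
connected components `P_j ∋ p_j` and `Q_j ∋ q_j`; (5) `cl(P_i) ∩ cl(P_j) = ∅` for `i ≠ j`,
`cl(Q_i) ∩ cl(Q_j) = ∅` for `i ≠ j`, and `cl(P_i) ∩ cl(Q_j) = ∅` for all `i, j`. -/
theorem conic_tubular_neighborhoods (s : ℕ) (hs : 0 < s) :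
    ∃ (L : Fin s → Set (Proj 2)) (p q : Fin s → Proj 2)
      (W : Set (Proj 2)) (Wf : Fin s → Set (Proj 2)) (P Q : Fin s → Set (Proj 2)),
      (∀ j, IsLine (L j)) ∧
      IsOpen W ∧ conic ⊆ W ∧
      (∀ j, IsOpen (Wf j) ∧ L j ⊆ Wf j) ∧
      (∀ j, p j ∈ conic ∧ q j ∈ conic) ∧
      -- (1)
      (∀ j, L j ∩ conic = {p j, q j} ∧ p j ≠ q j) ∧
      -- (2)
      (Function.Injective p ∧ Function.Injective q ∧ ∀ i j, p i ≠ q j) ∧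
      -- (3)
      (∀ j, Wf j ∩ W ∩ (Set.range p ∪ Set.range q) = {p j, q j}) ∧
      -- (4): `W_j ∩ W` has exactly the two connected components `P_j ∋ p_j`, `Q_j ∋ q_j`
      (∀ j, P j = connectedComponentIn (Wf j ∩ W) (p j) ∧
            Q j = connectedComponentIn (Wf j ∩ W) (q j) ∧
            P j ≠ Q j ∧ P j ∪ Q j = Wf j ∩ W) ∧
      -- (5)
      (∀ i j, i ≠ j → closure (P i) ∩ closure (P j) = ∅) ∧
      (∀ i j, i ≠ j → closure (Q i) ∩ closure (Q j) = ∅) ∧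
      (∀ i j, closure (P i) ∩ closure (Q j) = ∅) := by
  let a : Fin s → ℂ := fun j => ((j : ℕ) : ℂ) + 1
  have a_sub : ∀ i j, i ≠ j → 1 ≤ ‖a i - a j‖ := by
    intro i j hij
    have h : a i - a j = (((i : ℕ) - (j : ℕ) : ℤ) : ℂ) := by
      simp only [a]
      push_cast
      ring
    rw [h, Complex.norm_intCast]
    have : ((i : ℕ) : ℤ) - ((j : ℕ) : ℤ) ≠ 0 := by
      rw [sub_ne_zero]
      exact_mod_cast fun h => hij (Fin.ext h)
    exact_mod_cast Int.one_le_abs this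
  have a_sub_neg : ∀ i j, 1 ≤ ‖a i - -a j‖ := by
    intro i j
    have h : a i - -a j = (((i : ℕ) + (j : ℕ) + 2 : ℕ) : ℂ) := by
      simp only [a]
      push_cast
      ring
    rw [h, Complex.norm_natCast]
    exact_mod_cast (by omega : 1 ≤ (i : ℕ) + (j : ℕ) + 2)
  have neg_a_sub : ∀ i j, i ≠ j → 1 ≤ ‖-a i - -a j‖ := by
    intro i j hij
    rw [neg_sub_neg]
    exact a_sub j i hij.symm
  let R : ℝ := ((s : ℝ) + 1) ^ 2 + 1
  have hR : ∀ j, (‖a j‖ + 1) ^ 2 + 1 ≤ R := by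
    intro j
    have h : ‖a j‖ ≤ s := by
      have h' : a j = (((j : ℕ) + 1 : ℕ) : ℂ) := by simp [a]
      rw [h', Complex.norm_natCast]
      exact_mod_cast j.2
    simp only [R]
    gcongr
  refine ⟨fun j => chord (a j), fun j => affinePoint (a j) (a j ^ 2),
    fun j => affinePoint (-a j) ((-a j) ^ 2), projSet (n := 2) (NearConic R),
    fun j => projSet (n := 2) (NearLine R (a j)), fun j => projSet (n := 2) (NearPoint (a j)),
    fun j => projSet (n := 2) (NearPoint (-a j)), fun j => isLine_chord _, isOpen_nearConic R,
    conic_subset_nearConic R, fun j => ⟨isOpen_nearLine R _, chord_subset_nearLine (hR j)⟩,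
    fun j => ⟨affinePoint_mem_conic _, affinePoint_mem_conic _⟩,
    fun j => ⟨chord_inter_conic, affinePoint_ne (a_sub_neg j j)⟩,
    ⟨fun i j h => ?_, fun i j h => ?_, fun i j => affinePoint_ne (a_sub_neg i j)⟩,
    fun j => ?_, fun j => ?_, fun i j hij => closure_nearPoint_inter (a_sub i j hij),
    fun i j hij => closure_nearPoint_inter (neg_a_sub i j hij),
    fun i j => closure_nearPoint_inter (a_sub_neg i j)⟩
  · by_contra hij
    exact affinePoint_ne (a_sub i j hij) h
  · by_contra hij
    exact affinePoint_ne (neg_a_sub i j hij) h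
  · rw [nearLine_inter_nearConic (hR j)]
    apply Subset.antisymm
    · have far : ∀ b c : ℂ, 1 ≤ ‖b - c‖ →
          affinePoint b (b ^ 2) ∉ projSet (n := 2) (NearPoint c) := fun b c h =>
        (disjoint_nearPoint h).notMem_of_mem_left (affinePoint_mem_nearPoint_self b)
      rintro _ ⟨h | h, ⟨i, rfl⟩ | ⟨i, rfl⟩⟩
      · rcases eq_or_ne i j with rfl | hij
        · exact Or.inl rfl
        · exact absurd h (far _ _ (a_sub i j hij))
      · exact absurd h (far _ _ (by rw [norm_sub_rev]; exact a_sub_neg j i))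
      · exact absurd h (far _ _ (a_sub_neg i j))
      · rcases eq_or_ne i j with rfl | hij
        · exact Or.inr rfl
        · exact absurd h (far _ _ (neg_a_sub i j hij))
    · rintro _ (rfl | rfl)
      · exact ⟨Or.inl (affinePoint_mem_nearPoint_self _), Or.inl ⟨j, rfl⟩⟩
      · exact ⟨Or.inr (affinePoint_mem_nearPoint_self _), Or.inr ⟨j, rfl⟩⟩
  · have hd := disjoint_nearPoint (a_sub_neg j j)
    simp only [nearLine_inter_nearConic (hR j)]
    refine ⟨?_, ?_, ?_, trivial⟩
    · exact (connectedComponentIn_union_left (isOpen_nearPoint _) (isOpen_nearPoint _) hd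
        (isPreconnected_nearPoint _) (affinePoint_mem_nearPoint_self _)).symm
    · rw [union_comm]
      exact (connectedComponentIn_union_left (isOpen_nearPoint _) (isOpen_nearPoint _) hd.symm
        (isPreconnected_nearPoint _) (affinePoint_mem_nearPoint_self _)).symm
    · exact fun h => hd.notMem_of_mem_left (affinePoint_mem_nearPoint_self _)
        (h ▸ affinePoint_mem_nearPoint_self _)
end

section
/- Let X be a Hausdorff topological space, let W, W₁, …, W_s ⊆ X be open subsets, and suppose that for each j (1 ≤ j ≤ s) one has W ∩ W_j = P_j ∪ Q_j, where P_j and Q_j are disjoint open subsets of X whose closures satisfy cl(P_i) ∩ cl(P_j) = ∅ for i ≠ j, cl(Q_i) ∩ cl(Q_j) = ∅ for i ≠ j, and cl(P_i) ∩ cl(Q_j) = ∅ for all i, j. Let U₀ = W ⊔ W₁ ⊔ … ⊔ W_s (disjoint union) with the natural projection π₀ : U₀ → X, and let U₁ be the quotient of U₀ by the equivalence relation in which two distinct points x, y are equivalent if and only if π₀(x) = π₀(y) ∈ P₁ ∪ … ∪ P_s. Then U₁ (with the quotient topology) is Hausdorff, the induced map π₁ : U₁ → X is a local homeomorphism, and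 if moreover W and all W_j are connected and every P_j is nonempty, then U₁ is connected. -/
open Set

/-- The disjoint union `U₀ = W ⊔ W₁ ⊔ … ⊔ W_s` of the pieces, as a topological space. -/
def GlueTotal {X : Type*} [TopologicalSpace X] {s : ℕ} (W : Set X) (Wf : Fin s → Set X) :
    Type _ :=
  ↥W ⊕ (Σ j : Fin s, ↥(Wf j))

instance {X : Type*} [TopologicalSpace X] {s : ℕ} (W : Set X) (Wf : Fin s → Set X) :
    TopologicalSpace (GlueTotal W Wf) :=
  inferInstanceAs (TopologicalSpace (↥W ⊕ (Σ j : Fin s, ↥(Wf j))))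

/-- The natural projection `π₀ : U₀ → X`. -/
def glueProj {X : Type*} [TopologicalSpace X] {s : ℕ} (W : Set X) (Wf : Fin s → Set X) :
    GlueTotal W Wf → X :=
  Sum.elim (fun x => (x : X)) (fun x => (x.2 : X))

/-- The equivalence relation on `U₀`: two distinct points `x, y` are equivalent iff
`π₀ x = π₀ y ∈ P₁ ∪ … ∪ P_s`. -/
def glueRel₂ {X : Type*} [TopologicalSpace X] {s : ℕ} (W : Set X) (Wf : Fin s → Set X)
    (P : Fin s → Set X) : GlueTotal W Wf → GlueTotal W Wf → Prop :=
  fun x y => x = y ∨ (glueProj W Wf x = glueProj W Wf y ∧ glueProj W Wf x ∈ ⋃ j, P j)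

theorem IsLocallyInjective.isLocalHomeomorph {Y Z : Type*} [TopologicalSpace Y]
    [TopologicalSpace Z] {f : Y → Z} (hinj : IsLocallyInjective f) (hf : Continuous f)
    (hopen : IsOpenMap f) : IsLocalHomeomorph f := by
  rw [isLocalHomeomorph_iff_isOpenEmbedding_restrict]
  intro y
  obtain ⟨U, hU, hyU, hUinj⟩ := hinj y
  exact ⟨U, hU.mem_nhds hyU, .of_continuous_injective_isOpenMap (hf.comp continuous_subtype_val)
    (injOn_iff_injective.1 hUinj) (hopen.comp hU.isOpenMap_subtype_val)⟩

section Glue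

variable {X : Type*} [TopologicalSpace X] {s : ℕ} {W : Set X} {Wf P Q : Fin s → Set X}

instance [T2Space X] : T2Space (GlueTotal W Wf) :=
  inferInstanceAs (T2Space (↥W ⊕ (Σ j : Fin s, ↥(Wf j))))

theorem continuous_glueProj : Continuous (glueProj W Wf) :=
  continuous_subtype_val.sumElim (continuous_sigma fun _ => continuous_subtype_val)

theorem isOpenMap_glueProj (hW : IsOpen W) (hWf : ∀ j, IsOpen (Wf j)) :
    IsOpenMap (glueProj W Wf) :=
  isOpenMap_sumElim.2 ⟨hW.isOpenMap_subtype_val,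
    isOpenMap_sigma.2 fun j => (hWf j).isOpenMap_subtype_val⟩

/-- The inclusion of `W` in the disjoint union. -/
def glueInl (W : Set X) (Wf : Fin s → Set X) (x : W) : GlueTotal W Wf := Sum.inl x

/-- The inclusion of the `j`-th piece in the disjoint union. -/
def glueInr (W : Set X) (Wf : Fin s → Set X) (j : Fin s) (x : Wf j) : GlueTotal W Wf :=
  Sum.inr ⟨j, x⟩

theorem continuous_glueInl : Continuous (glueInl W Wf) := continuous_inl

theorem continuous_glueInr (j : Fin s) : Continuous (glueInr W Wf j) :=
  continuous_inr.comp continuous_sigmaMk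

theorem isOpen_range_glueInl : IsOpen (range (glueInl W Wf)) := isOpen_range_inl

theorem isOpen_range_glueInr (j : Fin s) : IsOpen (range (glueInr W Wf j)) :=
  (Topology.IsOpenEmbedding.inr.comp Topology.IsOpenEmbedding.sigmaMk).isOpen_range

theorem GlueTotal.cases_on {p : GlueTotal W Wf → Prop} (hl : ∀ x, p (glueInl W Wf x))
    (hr : ∀ j x, p (glueInr W Wf j x)) (a : GlueTotal W Wf) : p a := by
  rcases a with x | ⟨j, x⟩
  exacts [hl x, hr j x]

theorem isLocallyInjective_glueProj : IsLocallyInjective (glueProj W Wf) := by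
  refine GlueTotal.cases_on (fun x => ?_) fun j x => ?_
  · refine ⟨_, isOpen_range_glueInl, mem_range_self x, ?_⟩
    rintro _ ⟨a, rfl⟩ _ ⟨b, rfl⟩ h
    exact congrArg _ (Subtype.ext h)
  · refine ⟨_, isOpen_range_glueInr j, mem_range_self x, ?_⟩
    rintro _ ⟨a, rfl⟩ _ ⟨b, rfl⟩ h
    exact congrArg _ (Subtype.ext h)

theorem glueRel₂_equivalence : Equivalence (glueRel₂ W Wf P) where
  refl _ := Or.inl rfl
  symm := by
    rintro a b (rfl | ⟨h, hP⟩)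
    exacts [Or.inl rfl, Or.inr ⟨h.symm, h ▸ hP⟩]
  trans := by
    rintro a b c (rfl | ⟨h, hP⟩) (rfl | ⟨h', hP'⟩)
    exacts [Or.inl rfl, Or.inr ⟨h', hP'⟩, Or.inr ⟨h, hP⟩, Or.inr ⟨h.trans h', hP⟩]

theorem quot_mk_glueRel₂_eq_iff {a b : GlueTotal W Wf} :
    Quot.mk (glueRel₂ W Wf P) a = Quot.mk (glueRel₂ W Wf P) b ↔ glueRel₂ W Wf P a b :=
  glueRel₂_equivalence.quot_mk_eq_iff a b

theorem isOpenMap_quot_mk_glueRel₂ (hW : IsOpen W) (hWf : ∀ j, IsOpen (Wf j))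
    (hP : ∀ j, IsOpen (P j)) : IsOpenMap (Quot.mk (glueRel₂ W Wf P)) := by
  intro S hS
  rw [← isQuotientMap_quot_mk.isOpen_preimage]
  have h : Quot.mk (glueRel₂ W Wf P) ⁻¹' (Quot.mk (glueRel₂ W Wf P) '' S) =
      S ∪ glueProj W Wf ⁻¹' (glueProj W Wf '' S ∩ ⋃ j, P j) := by
    ext a
    simp only [mem_preimage, mem_image, quot_mk_glueRel₂_eq_iff]
    constructor
    · rintro ⟨b, hb, rfl | ⟨h, hP⟩⟩
      exacts [Or.inl hb, Or.inr ⟨⟨b, hb, h⟩, h ▸ hP⟩]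
    · rintro (ha | ⟨⟨b, hb, h⟩, hP⟩)
      exacts [⟨a, ha, Or.inl rfl⟩, ⟨b, hb, Or.inr ⟨h, h ▸ hP⟩⟩]
  rw [h]
  exact hS.union ((((isOpenMap_glueProj hW hWf) S hS).inter (isOpen_iUnion hP)).preimage
    continuous_glueProj)

theorem glueProj_eq_of_glueRel₂ {a b : GlueTotal W Wf} (h : glueRel₂ W Wf P a b) :
    glueProj W Wf a = glueProj W Wf b := by
  rcases h with rfl | ⟨h, -⟩
  exacts [rfl, h]

theorem notMem_closure_of_mem_inter (hdecomp : ∀ j, W ∩ Wf j = P j ∪ Q j)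
    (hPQ : ∀ i j, closure (P i) ∩ closure (Q j) = ∅) {x : X} (hxP : x ∉ ⋃ j, P j) {j : Fin s}
    (hxW : x ∈ W) (hxj : x ∈ Wf j) : x ∉ closure (⋃ j, P j) := by
  rw [closure_iUnion_of_finite, mem_iUnion]
  rintro ⟨k, hk⟩
  rcases (hdecomp j).subset ⟨hxW, hxj⟩ with h | h
  · exact hxP (mem_iUnion_of_mem j h)
  · exact (hPQ k j).subset ⟨hk, subset_closure h⟩

theorem eq_of_mem_closure (hWf : ∀ j, IsOpen (Wf j)) (hdecomp : ∀ j, W ∩ Wf j = P j ∪ Q j)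
    (hPP : ∀ i j, i ≠ j → closure (P i) ∩ closure (P j) = ∅)
    (hPQ : ∀ i j, closure (P i) ∩ closure (Q j) = ∅) {x : X} {i k : Fin s}
    (hxi : x ∈ Wf i) (hxk : x ∈ closure (P k)) : k = i := by
  obtain ⟨y, hyi, hyk⟩ := mem_closure_iff.1 hxk _ (hWf i) hxi
  have hyW : y ∈ W := ((hdecomp k).symm.subset (Or.inl hyk)).1
  by_contra hki
  rcases (hdecomp i).subset ⟨hyW, hyi⟩ with h | h
  · exact (hPP k i hki).subset ⟨subset_closure hyk, subset_closure h⟩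
  · exact (hPQ k i).subset ⟨subset_closure hyk, subset_closure h⟩

theorem glueProj_notMem_closure (hWf : ∀ j, IsOpen (Wf j))
    (hdecomp : ∀ j, W ∩ Wf j = P j ∪ Q j)
    (hPP : ∀ i j, i ≠ j → closure (P i) ∩ closure (P j) = ∅)
    (hPQ : ∀ i j, closure (P i) ∩ closure (Q j) = ∅) {a b : GlueTotal W Wf}
    (hab : a ≠ b) (h : glueProj W Wf a = glueProj W Wf b) (ha : glueProj W Wf a ∉ ⋃ j, P j) :
    glueProj W Wf a ∉ closure (⋃ j, P j) := by
  induction a using GlueTotal.cases_on with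
  | hl x =>
    induction b using GlueTotal.cases_on with
    | hl y => exact absurd (congrArg _ (Subtype.ext h)) hab
    | hr j y => exact notMem_closure_of_mem_inter hdecomp hPQ ha x.2 (mem_of_eq_of_mem h y.2)
  | hr i x =>
    induction b using GlueTotal.cases_on with
    | hl y => exact notMem_closure_of_mem_inter hdecomp hPQ ha (mem_of_eq_of_mem h y.2) x.2
    | hr j y =>
      rw [closure_iUnion_of_finite, mem_iUnion]
      rintro ⟨k, hk⟩
      obtain rfl := eq_of_mem_closure hWf hdecomp hPP hPQ x.2 hk
      obtain rfl := eq_of_mem_closure hWf hdecomp hPP hPQ y.2 (mem_of_eq_of_mem h.symm hk)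
      exact hab (congrArg _ (Subtype.ext h))

theorem t2Space_quot_glueRel₂ [T2Space X] (hW : IsOpen W) (hWf : ∀ j, IsOpen (Wf j))
    (hP : ∀ j, IsOpen (P j)) (hdecomp : ∀ j, W ∩ Wf j = P j ∪ Q j)
    (hPP : ∀ i j, i ≠ j → closure (P i) ∩ closure (P j) = ∅)
    (hPQ : ∀ i j, closure (P i) ∩ closure (Q j) = ∅) :
    T2Space (Quot (glueRel₂ W Wf P)) := by
  have hmk := isOpenMap_quot_mk_glueRel₂ hW hWf hP
  have hdisj (A B : Set (GlueTotal W Wf)) (h : ∀ a ∈ A, ∀ b ∈ B, ¬ glueRel₂ W Wf P a b) :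
      Disjoint (Quot.mk (glueRel₂ W Wf P) '' A) (Quot.mk (glueRel₂ W Wf P) '' B) := by
    rw [disjoint_left]
    rintro _ ⟨a, ha, rfl⟩ ⟨b, hb, hba⟩
    exact h a ha b hb (quot_mk_glueRel₂_eq_iff.1 hba.symm)
  refine ⟨?_⟩
  rintro ⟨a⟩ ⟨b⟩ hab
  have hrel : ¬ glueRel₂ W Wf P a b := fun h => hab (Quot.sound h)
  by_cases h : glueProj W Wf a = glueProj W Wf b
  · have hne : a ≠ b := fun h' => hrel (Or.inl h')
    have hcl := glueProj_notMem_closure hWf hdecomp hPP hPQ hne h fun h' => hrel (Or.inr ⟨h, h'⟩)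
    obtain ⟨A, B, hA, hB, haA, hbB, hAB⟩ := t2_separation hne
    have hV : IsOpen (glueProj W Wf ⁻¹' (closure (⋃ j, P j))ᶜ) :=
      isClosed_closure.isOpen_compl.preimage continuous_glueProj
    refine ⟨_, _, hmk _ (hA.inter hV), hmk _ hB, mem_image_of_mem _ ⟨haA, hcl⟩,
      mem_image_of_mem _ hbB, hdisj _ _ ?_⟩
    rintro u ⟨huA, huV⟩ v hvB (rfl | ⟨-, huP⟩)
    exacts [disjoint_left.1 hAB huA hvB, huV (subset_closure huP)]
  · obtain ⟨A, B, hA, hB, haA, hbB, hAB⟩ := t2_separation h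
    refine ⟨_, _, hmk _ (hA.preimage continuous_glueProj), hmk _ (hB.preimage continuous_glueProj),
      mem_image_of_mem _ haA, mem_image_of_mem _ hbB, hdisj _ _ fun u hu v hv huv => ?_⟩
    exact disjoint_left.1 hAB hu (glueProj_eq_of_glueRel₂ huv ▸ hv)

theorem isLocalHomeomorph_of_comp_quot_mk_glueRel₂ (hW : IsOpen W) (hWf : ∀ j, IsOpen (Wf j))
    (hP : ∀ j, IsOpen (P j)) {f : Quot (glueRel₂ W Wf P) → X}
    (hf : f ∘ Quot.mk (glueRel₂ W Wf P) = glueProj W Wf) : IsLocalHomeomorph f := by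
  have hcont : Continuous f :=
    isQuotientMap_quot_mk.continuous_iff.2 (hf ▸ continuous_glueProj)
  refine IsLocallyInjective.isLocalHomeomorph ?_ hcont ?_
  · rintro ⟨a⟩
    obtain ⟨U, hU, haU, hinj⟩ := isLocallyInjective_glueProj a
    refine ⟨_, isOpenMap_quot_mk_glueRel₂ hW hWf hP U hU, mem_image_of_mem _ haU, ?_⟩
    rw [← hf] at hinj
    exact hinj.image_of_comp
  · intro S hS
    rw [← image_preimage_eq S Quot.mk_surjective, ← image_comp, hf]
    exact isOpenMap_glueProj hW hWf _ (hS.preimage continuous_quot_mk)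

theorem connectedSpace_quot_glueRel₂ (hPW : ∀ j, P j ⊆ W ∩ Wf j) (hWc : IsConnected W)
    (hWfc : ∀ j, IsConnected (Wf j)) (hPne : ∀ j, (P j).Nonempty) :
    ConnectedSpace (Quot (glueRel₂ W Wf P)) := by
  obtain ⟨w, hw⟩ := hWc.nonempty
  let q : GlueTotal W Wf → _ := Quot.mk (glueRel₂ W Wf P)
  have hl : IsPreconnected (range (q ∘ glueInl W Wf)) := by
    have := isPreconnected_iff_preconnectedSpace.1 hWc.isPreconnected
    exact isPreconnected_range (continuous_quot_mk.comp continuous_glueInl)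
  have hr (j : Fin s) : IsPreconnected (range (q ∘ glueInr W Wf j)) := by
    have := isPreconnected_iff_preconnectedSpace.1 (hWfc j).isPreconnected
    exact isPreconnected_range (continuous_quot_mk.comp (continuous_glueInr j))
  have : PreconnectedSpace (Quot (glueRel₂ W Wf P)) := by
    refine ⟨isPreconnected_of_forall (q (glueInl W Wf ⟨w, hw⟩)) ?_⟩
    rintro ⟨a⟩ -
    induction a using GlueTotal.cases_on with
    | hl x => exact ⟨range (q ∘ glueInl W Wf), subset_univ _, ⟨⟨w, hw⟩, rfl⟩, ⟨x, rfl⟩, hl⟩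
    | hr j x =>
      obtain ⟨p, hp⟩ := hPne j
      have hpq : q (glueInr W Wf j ⟨p, (hPW j hp).2⟩) =
          q (glueInl W Wf ⟨p, (hPW j hp).1⟩) :=
        Quot.sound (Or.inr ⟨rfl, mem_iUnion_of_mem j hp⟩)
      exact ⟨range (q ∘ glueInl W Wf) ∪ range (q ∘ glueInr W Wf j), subset_univ _,
        Or.inl ⟨⟨w, hw⟩, rfl⟩, Or.inr ⟨x, rfl⟩,
        hl.union _ ⟨⟨p, (hPW j hp).1⟩, rfl⟩ ⟨_, hpq⟩ (hr j)⟩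
  exact { toNonempty := ⟨q (glueInl W Wf ⟨w, hw⟩)⟩ }

end Glue

/-- Let `X` be Hausdorff, `W, W₁, …, W_s ⊆ X` open, with
`W ∩ W_j = P_j ∪ Q_j` where `P_j, Q_j` are disjoint open sets whose closures satisfy
`cl(P_i) ∩ cl(P_j) = ∅ (i ≠ j)`, `cl(Q_i) ∩ cl(Q_j) = ∅ (i ≠ j)`, `cl(P_i) ∩ cl(Q_j) = ∅`.
Let `U₁` be the quotient of `U₀ = W ⊔ W₁ ⊔ … ⊔ W_s` identifying distinct points with the
same image lying in `P₁ ∪ … ∪ P_s`.  Then `U₁` is Hausdorff, the induced map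
`π₁ : U₁ → X` is a local homeomorphism, and if moreover `W` and all `W_j` are connected
and all `P_j` are nonempty, then `U₁` is connected. -/
theorem glued_surface_hausdorff_localHomeo_connected
    {X : Type*} [TopologicalSpace X] [T2Space X] {s : ℕ}
    (W : Set X) (Wf P Q : Fin s → Set X)
    (hW : IsOpen W) (hWf : ∀ j, IsOpen (Wf j))
    (hPopen : ∀ j, IsOpen (P j)) (hQopen : ∀ j, IsOpen (Q j))
    (hPQdisj : ∀ j, Disjoint (P j) (Q j))
    (hdecomp : ∀ j, W ∩ Wf j = P j ∪ Q j)
    (hPP : ∀ i j, i ≠ j → closure (P i) ∩ closure (P j) = ∅)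
    (hQQ : ∀ i j, i ≠ j → closure (Q i) ∩ closure (Q j) = ∅)
    (hPQ : ∀ i j, closure (P i) ∩ closure (Q j) = ∅) :
    T2Space (Quot (glueRel₂ W Wf P)) ∧
    (∀ π₁ : Quot (glueRel₂ W Wf P) → X,
        π₁ ∘ Quot.mk (glueRel₂ W Wf P) = glueProj W Wf → IsLocalHomeomorph π₁) ∧
    ((IsConnected W ∧ (∀ j, IsConnected (Wf j)) ∧ ∀ j, (P j).Nonempty) →
        ConnectedSpace (Quot (glueRel₂ W Wf P))) := by
  exact ⟨t2Space_quot_glueRel₂ hW hWf hPopen hdecomp hPP hPQ,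
    fun _ hπ => isLocalHomeomorph_of_comp_quot_mk_glueRel₂ hW hWf hPopen hπ,
    fun ⟨hWc, hWfc, hPne⟩ => connectedSpace_quot_glueRel₂
      (fun j => (hdecomp j).symm ▸ subset_union_left) hWc hWfc hPne⟩
end
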